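/- arXiv:2605.25462 — 2 statements merged into one kernel-verified Lean document; each statement's English description precedes it below -/
import Mathlib

section
/- Let 0 < ε < δ and K ≥ 2δ, and set A_{ε,δ} := {Z ∈ ℝ⁴ : ε < |Z| < δ}, B_K := {z ∈ ℝ² : |z| < K}, and Q_K := A_{ε,δ} × B_K ⊂ ℝ⁴ × ℝ². Let 0 < λ ≤ Λ' and let a : ℝ⁴ × ℝ² → ℝ be continuously differentiable with λ ≤ a ≤ Λ' everywhere. Let v be continuous on the closure of Q_K, twice continuously differentiable on Q_K, with 0 ≤ v ≤ 1, satisfying the pointwise subsolution inequality Δ_Z v + div_z(a·∇_z v) ≥ 0 in Q_K (where Δ_Z is the Laplacian in the ℝ⁴-variables and div_z, ∇_z are taken in the ℝ²-variables), and such that v(Z,z) = 0 whenever |Z| = ε or |Z| = δ and |z| ≤ K. Then there exist constants C > 0 and γ > 0, depending only on λ and Λ', such that sup {v(Z,z) : Z ∈ A_{ε,δ}, |z| < δ/2} ≤ C·e^{−γ·K/δ}. -/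
open Real

noncomputable section

/-- The coordinate direction in the `ℝ⁴`-factor. -/
def dirZ (i : Fin 4) : EuclideanSpace ℝ (Fin 4) × EuclideanSpace ℝ (Fin 2) :=
  (EuclideanSpace.single i 1, 0)

/-- The coordinate direction in the `ℝ²`-factor. -/
def dirz (j : Fin 2) : EuclideanSpace ℝ (Fin 4) × EuclideanSpace ℝ (Fin 2) :=
  (0, EuclideanSpace.single j 1)

/-- The annulus-cylinder `Q_K = {ε < |Z| < δ} × {|z| < K}`. -/
def annCyl (ε δ K : ℝ) : Set (EuclideanSpace ℝ (Fin 4) × EuclideanSpace ℝ (Fin 2)) :=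
  {p | (ε < ‖p.1‖ ∧ ‖p.1‖ < δ) ∧ ‖p.2‖ < K}

/-- The subsolution inequality `Δ_Z v + div_z(a∇_z v) ≥ 0` at a point. -/
def SubSolAt (a v : EuclideanSpace ℝ (Fin 4) × EuclideanSpace ℝ (Fin 2) → ℝ)
    (p : EuclideanSpace ℝ (Fin 4) × EuclideanSpace ℝ (Fin 2)) : Prop :=
  0 ≤ (∑ i : Fin 4, fderiv ℝ (fun q => fderiv ℝ v q (dirZ i)) p (dirZ i)) +
      ∑ j : Fin 2, fderiv ℝ (fun q => a q * fderiv ℝ v q (dirz j)) p (dirz j)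

open MeasureTheory Set Filter Topology

/-- The ambient space `ℝ⁴ × ℝ²`. -/
abbrev Pt := EuclideanSpace ℝ (Fin 4) × EuclideanSpace ℝ (Fin 2)

instance : (volume : Measure Pt).IsAddHaarMeasure :=
  inferInstanceAs (((volume : Measure (EuclideanSpace ℝ (Fin 4))).prod
    (volume : Measure (EuclideanSpace ℝ (Fin 2)))).IsAddHaarMeasure)

theorem integrable_fderiv_apply {G : Pt → ℝ} (hG : ContDiff ℝ 1 G) (hc : HasCompactSupport G)
    (e : Pt) : Integrable (fun p => fderiv ℝ G p e) :=
  ((hG.continuous_fderiv one_ne_zero).clm_apply continuous_const).integrable_of_hasCompactSupport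
    (hc.fderiv_apply ℝ e)

theorem integral_fderiv_apply_eq_zero {G : Pt → ℝ} (hG : ContDiff ℝ 1 G)
    (hc : HasCompactSupport G) (e : Pt) : ∫ p, fderiv ℝ G p e = 0 := by
  have h := integral_mul_fderiv_eq_neg_fderiv_mul_of_integrable (μ := (volume : Measure Pt))
    (f := fun _ => (1 : ℝ)) (g := G) (v := e) (by simp)
    (by simpa using integrable_fderiv_apply hG hc e)
    (by simpa using hG.continuous.integrable_of_hasCompactSupport hc)
    (fun x _ => differentiableAt_const _) (fun x _ => hG.differentiable one_ne_zero x)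
  simpa using h

/-- The squared length of the gradient of `u`. -/
def gradSq (u : Pt → ℝ) (p : Pt) : ℝ :=
  ∑ i : Fin 4, (fderiv ℝ u p (dirZ i)) ^ 2 + ∑ j : Fin 2, (fderiv ℝ u p (dirz j)) ^ 2

theorem gradSq_nonneg (u : Pt → ℝ) (p : Pt) : 0 ≤ gradSq u p := by
  unfold gradSq; positivity

theorem eq_sum_dir (q : Pt) : q = ∑ i : Fin 4, q.1 i • dirZ i + ∑ j : Fin 2, q.2 j • dirz j := by
  ext k
  · simp [dirZ, dirz, Prod.fst_sum, Pi.single_apply]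
  · fin_cases k <;> simp [dirZ, dirz, Prod.snd_sum]

theorem norm_sq_fderiv_le (u : Pt → ℝ) (p : Pt) : ‖fderiv ℝ u p‖ ^ 2 ≤ 6 * gradSq u p := by
  set L := fderiv ℝ u p with hL
  have h1 : ‖L‖ ≤ ∑ i : Fin 4, |L (dirZ i)| + ∑ j : Fin 2, |L (dirz j)| := by
    refine L.opNorm_le_bound (by positivity) fun q => ?_
    have hq1 : ∀ i, |q.1 i| ≤ ‖q‖ := fun i => (PiLp.norm_apply_le q.1 i).trans (norm_fst_le q)
    have hq2 : ∀ i, |q.2 i| ≤ ‖q‖ := fun i => (PiLp.norm_apply_le q.2 i).trans (norm_snd_le q)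
    conv_lhs => rw [eq_sum_dir q]
    rw [map_add, map_sum, map_sum, add_mul, Finset.sum_mul, Finset.sum_mul, Real.norm_eq_abs]
    refine (abs_add_le _ _).trans (add_le_add ?_ ?_)
    · refine (Finset.abs_sum_le_sum_abs _ _).trans (Finset.sum_le_sum fun i _ => ?_)
      rw [map_smul, smul_eq_mul, abs_mul, mul_comm]
      gcongr
      exact hq1 i
    · refine (Finset.abs_sum_le_sum_abs _ _).trans (Finset.sum_le_sum fun i _ => ?_)
      rw [map_smul, smul_eq_mul, abs_mul, mul_comm]
      gcongr
      exact hq2 i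
  have h2 := pow_le_pow_left₀ (norm_nonneg L) h1 2
  refine h2.trans ?_
  have hZ := sq_sum_le_card_mul_sum_sq (s := (Finset.univ : Finset (Fin 4 ⊕ Fin 2)))
    (f := fun k => |L (Sum.elim dirZ dirz k)|)
  simpa [gradSq, ← hL] using hZ

theorem continuous_gradSq {u : Pt → ℝ} (hu : ContDiff ℝ 1 u) : Continuous (gradSq u) := by
  have h := hu.continuous_fderiv one_ne_zero
  unfold gradSq
  fun_prop

theorem hasCompactSupport_gradSq {u : Pt → ℝ} (hc : HasCompactSupport u) :
    HasCompactSupport (gradSq u) := by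
  refine (hc.fderiv (𝕜 := ℝ)).mono ?_
  intro p hp
  contrapose! hp
  simp only [Function.mem_support, not_not] at hp ⊢
  simp [gradSq, hp]

theorem integrable_gradSq {u : Pt → ℝ} (hu : ContDiff ℝ 1 u) (hc : HasCompactSupport u) :
    Integrable (gradSq u) :=
  (continuous_gradSq hu).integrable_of_hasCompactSupport (hasCompactSupport_gradSq hc)

/-- Poincaré's inequality in the `ℝ⁴`-variables. -/
theorem integral_sq_le_gradSq {u : Pt → ℝ} (hu : ContDiff ℝ 1 u) (hc : HasCompactSupport u)
    {δ : ℝ} (hδ : 0 < δ) (hs : ∀ p : Pt, δ ≤ ‖p.1‖ → u p = 0) :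
    ∫ p, u p ^ 2 ≤ 4 * δ ^ 2 * ∫ p, gradSq u p := by
  let l : Pt →L[ℝ] ℝ := (EuclideanSpace.proj (0 : Fin 4)).comp (ContinuousLinearMap.fst ℝ _ _)
  have hl : ∀ p : Pt, l p = p.1 0 := fun p => rfl
  have hG : ContDiff ℝ 1 (fun p => l p * u p ^ 2) := l.contDiff.mul (hu.pow 2)
  have hsq : HasCompactSupport (fun p => u p ^ 2) := hc.mono fun p hp => by
    contrapose! hp
    simp only [Function.mem_support, not_not] at hp ⊢
    simp [hp]
  have hGc : HasCompactSupport (fun p => l p * u p ^ 2) := hsq.mul_left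
  have h0 := integral_fderiv_apply_eq_zero hG hGc (dirZ 0)
  have hI := integrable_fderiv_apply hG hGc (dirZ 0)
  have hint : Integrable (fun p => u p ^ 2) :=
    (hu.continuous.pow 2).integrable_of_hasCompactSupport hsq
  have hpt : ∀ p, u p ^ 2 ≤ 4 * δ ^ 2 * gradSq u p
      + 2 * fderiv ℝ (fun p => l p * u p ^ 2) p (dirZ 0) := by
    intro p
    have hd : fderiv ℝ (fun p => l p * u p ^ 2) p (dirZ 0)
        = u p ^ 2 + 2 * l p * (u p * fderiv ℝ u p (dirZ 0)) := by
      have hup : HasFDerivAt u (fderiv ℝ u p) p :=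
        (hu.differentiable one_ne_zero p).hasFDerivAt
      have hm : HasFDerivAt (fun p => l p * u p ^ 2) _ p := l.hasFDerivAt.mul (hup.pow 2)
      rw [hm.fderiv]
      simp [hl, dirZ]
      ring
    rw [hd]
    have hg : (fderiv ℝ u p (dirZ 0)) ^ 2 ≤ gradSq u p := by
      have h1 := Finset.single_le_sum (f := fun i : Fin 4 => (fderiv ℝ u p (dirZ i)) ^ 2)
        (fun i _ => sq_nonneg _) (Finset.mem_univ 0)
      have h2 : 0 ≤ ∑ j : Fin 2, (fderiv ℝ u p (dirz j)) ^ 2 := by positivity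
      unfold gradSq
      linarith
    by_cases hp : δ ≤ ‖p.1‖
    · rw [hs p hp]
      have := gradSq_nonneg u p
      simp only [ne_eq, OfNat.ofNat_ne_zero, not_false_eq_true, zero_pow, zero_mul, mul_zero,
        add_zero]
      positivity
    · have hlp : (l p) ^ 2 ≤ δ ^ 2 := by
        rw [hl]
        refine sq_le_sq' ?_ ?_ <;>
        linarith [abs_le.1 (PiLp.norm_apply_le p.1 0)]
      have h3 := mul_le_mul hlp hg (sq_nonneg _) (sq_nonneg _)
      nlinarith [sq_nonneg (u p + 2 * l p * fderiv ℝ u p (dirZ 0))]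
  have := integral_mono hint (((integrable_gradSq hu hc).const_mul (4 * δ ^ 2)).add
    (hI.const_mul 2)) hpt
  simp only [Pi.add_apply] at this
  rw [integral_add ((integrable_gradSq hu hc).const_mul _) (hI.const_mul 2),
    integral_const_mul, integral_const_mul, h0] at this
  linarith

/-- The Sobolev inequality `W^{1,2} ⊂ L³` in six dimensions. -/
theorem exists_sobolev_const : ∃ C > (0 : ℝ), ∀ u : Pt → ℝ, ContDiff ℝ 1 u →
    HasCompactSupport u → (∫ p, |u p| ^ 3) ^ 2 ≤ C * (∫ p, gradSq u p) ^ 3 := by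
  set S : NNReal := SNormLESNormFDerivOfEqConst ℝ (volume : Measure Pt) 2
  refine ⟨(S : ℝ) ^ 6 * 6 ^ 3 + 1, by positivity, fun u hu hc => ?_⟩
  have h := eLpNorm_le_eLpNorm_fderiv_of_eq (volume : Measure Pt) hu hc (p := 2) (p' := 3)
    (by norm_num) (by simp) (by simp; norm_num)
  have hfc := hu.continuous_fderiv one_ne_zero
  have hm3 : MemLp u 3 := hu.continuous.memLp_of_hasCompactSupport hc
  have hm2 : MemLp (fderiv ℝ u) 2 := hfc.memLp_of_hasCompactSupport (hc.fderiv (𝕜 := ℝ))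
  push_cast at h
  rw [hm3.eLpNorm_eq_integral_rpow_norm (by norm_num) (by norm_num),
    hm2.eLpNorm_eq_integral_rpow_norm (by norm_num) (by norm_num), ← ENNReal.ofReal_coe_nnreal,
    ← ENNReal.ofReal_mul (by positivity), ENNReal.ofReal_le_ofReal_iff (by positivity)] at h
  simp only [ENNReal.toReal_ofNat, Real.rpow_ofNat, Real.norm_eq_abs] at h
  set A := ∫ p, |u p| ^ 3
  set B := ∫ p, ‖fderiv ℝ u p‖ ^ 2
  have hA : 0 ≤ A := integral_nonneg fun p => by positivity
  have hB : 0 ≤ B := integral_nonneg fun p => by positivity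
  have hBg : B ≤ 6 * ∫ p, gradSq u p := by
    rw [← integral_const_mul]
    exact integral_mono (hm2.integrable_norm_pow (by norm_num))
      ((integrable_gradSq hu hc).const_mul 6) (norm_sq_fderiv_le u)
  have hg : 0 ≤ ∫ p, gradSq u p := integral_nonneg (gradSq_nonneg u)
  have h6 := pow_le_pow_left₀ (by positivity) h 6
  have e1 : (A ^ (3 : ℝ)⁻¹) ^ 6 = A ^ 2 := by
    rw [← Real.rpow_natCast, ← Real.rpow_mul hA]; norm_num
  have e2 : (B ^ (2 : ℝ)⁻¹) ^ 6 = B ^ 3 := by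
    rw [← Real.rpow_natCast, ← Real.rpow_mul hB]; norm_num
  rw [mul_pow, e1, e2] at h6
  calc A ^ 2 ≤ (S : ℝ) ^ 6 * B ^ 3 := h6
    _ ≤ (S : ℝ) ^ 6 * (6 * ∫ p, gradSq u p) ^ 3 := by gcongr
    _ ≤ _ := by
      have : 0 ≤ (∫ p, gradSq u p) ^ 3 := by positivity
      nlinarith

/-- Cutoff functions in the `ℝ²`-variables with a gradient bound. -/
theorem exists_cutoff : ∃ C > (0 : ℝ), ∀ r R : ℝ, 0 < r → r < R →
    ∃ η : EuclideanSpace ℝ (Fin 2) → ℝ, ContDiff ℝ 2 η ∧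
      (∀ z, ‖z‖ ≤ r → η z = 1) ∧ (∀ z, R ≤ ‖z‖ → η z = 0) ∧
      (∀ z, ‖z‖ ≤ r → fderiv ℝ η z = 0) ∧ (∀ z, R ≤ ‖z‖ → fderiv ℝ η z = 0) ∧
      ∀ z, ‖fderiv ℝ η z‖ ≤ C / (R - r) := by
  have hS : ContDiff ℝ 2 smoothTransition := Real.smoothTransition.contDiff (n := 2)
  obtain ⟨M, hM⟩ := (isCompact_Icc (a := (0 : ℝ)) (b := 1)).exists_bound_of_continuousOn
    (hS.continuous_deriv (by norm_num)).continuousOn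
  have hM0 : 0 ≤ M := (norm_nonneg _).trans (hM 0 (by simp))
  refine ⟨2 * M + 1, by positivity, fun r R hr hR => ?_⟩
  have hden : 0 < R ^ 2 - r ^ 2 := by nlinarith
  let ψ : EuclideanSpace ℝ (Fin 2) → ℝ := fun z => (R ^ 2 - ‖z‖ ^ 2) / (R ^ 2 - r ^ 2)
  let η : EuclideanSpace ℝ (Fin 2) → ℝ := fun z => smoothTransition (ψ z)
  have hone : ∀ z, ‖z‖ ≤ r → η z = 1 := fun z hz =>
    Real.smoothTransition.one_of_one_le ((one_le_div hden).2
      (by nlinarith [norm_nonneg z]))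
  have hzero : ∀ z, R ≤ ‖z‖ → η z = 0 := fun z hz =>
    Real.smoothTransition.zero_of_nonpos (div_nonpos_of_nonpos_of_nonneg (by nlinarith) hden.le)
  have hd1 : ∀ z, ‖z‖ ≤ r → fderiv ℝ η z = 0 := fun z hz =>
    IsLocalMax.fderiv_eq_zero (Eventually.of_forall fun y => by
      rw [hone z hz]; exact Real.smoothTransition.le_one _)
  have hd0 : ∀ z, R ≤ ‖z‖ → fderiv ℝ η z = 0 := fun z hz =>
    IsLocalMin.fderiv_eq_zero (Eventually.of_forall fun y => by
      rw [hzero z hz]; exact Real.smoothTransition.nonneg _)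
  have hψ : ContDiff ℝ 2 ψ := (contDiff_const.sub (contDiff_norm_sq ℝ)).div_const _
  refine ⟨η, hS.comp hψ, hone, hzero, hd1, hd0, fun z => ?_⟩
  have hpos : 0 < R - r := by linarith
  by_cases h1 : ‖z‖ ≤ r
  · rw [hd1 z h1, norm_zero]; positivity
  by_cases h2 : R ≤ ‖z‖
  · rw [hd0 z h2, norm_zero]; positivity
  push Not at h1 h2
  have hψ' : HasFDerivAt ψ ((R ^ 2 - r ^ 2)⁻¹ •
      (-((2 : ℕ) • (innerSL ℝ z : EuclideanSpace ℝ (Fin 2) →L[ℝ] ℝ)))) z := by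
    have := ((hasStrictFDerivAt_norm_sq z).hasFDerivAt.const_sub (R ^ 2)).mul_const
      ((R ^ 2 - r ^ 2)⁻¹)
    simpa only [ψ, div_eq_mul_inv] using this
  have hη : HasFDerivAt η _ z :=
    ((hS.differentiable (by norm_num) (ψ z)).hasDerivAt).comp_hasFDerivAt z hψ'
  rw [hη.fderiv, norm_smul, norm_smul, norm_neg, ← Nat.cast_smul_eq_nsmul ℝ, norm_smul,
    innerSL_apply_norm, norm_inv, Real.norm_of_nonneg hden.le]
  have hb : ‖deriv smoothTransition (ψ z)‖ ≤ M := by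
    refine hM _ ⟨div_nonneg (by nlinarith [norm_nonneg z]) hden.le, (div_le_one hden).2 ?_⟩
    nlinarith
  rw [le_div_iff₀ hpos]
  have e : (R ^ 2 - r ^ 2)⁻¹ * (R - r) = (R + r)⁻¹ := by
    have : R ^ 2 - r ^ 2 = (R + r) * (R - r) := by ring
    rw [this, mul_inv, mul_assoc, inv_mul_cancel₀ hpos.ne', mul_one]
  have hRr : 0 < R + r := by linarith
  have hz : (R + r)⁻¹ * ‖z‖ ≤ 1 := by
    rw [inv_mul_le_iff₀ (by linarith)]; linarith
  calc ‖deriv smoothTransition (ψ z)‖ * ((R ^ 2 - r ^ 2)⁻¹ * (‖((2 : ℕ) : ℝ)‖ * ‖z‖)) * (R - r)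
      = 2 * ‖deriv smoothTransition (ψ z)‖ * ((R + r)⁻¹ * ‖z‖) := by
        rw [← e]; simp; ring
    _ ≤ 2 * M * 1 := by
        have : 0 ≤ (R + r)⁻¹ * ‖z‖ := by positivity
        gcongr
    _ ≤ 2 * M + 1 := by linarith

/-- The closed cylinder `{|Z| ≤ δ} × {|z| ≤ r}`. -/
def cyl (δ r : ℝ) : Set Pt := Metric.closedBall 0 δ ×ˢ Metric.closedBall 0 r

theorem mem_cyl {δ r : ℝ} {p : Pt} : p ∈ cyl δ r ↔ ‖p.1‖ ≤ δ ∧ ‖p.2‖ ≤ r := by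
  simp [cyl]

theorem isCompact_cyl (δ r : ℝ) : IsCompact (cyl δ r) :=
  (isCompact_closedBall _ _).prod (isCompact_closedBall _ _)

theorem cyl_mono {δ r R : ℝ} (h : r ≤ R) : cyl δ r ⊆ cyl δ R := fun p hp => by
  rw [mem_cyl] at hp ⊢
  exact ⟨hp.1, hp.2.trans h⟩

theorem hasCompactSupport_of_eq_zero {f : Pt → ℝ} {δ R : ℝ} (h1 : ∀ p : Pt, δ ≤ ‖p.1‖ → f p = 0)
    (h2 : ∀ p : Pt, R ≤ ‖p.2‖ → f p = 0) : HasCompactSupport f := by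
  refine HasCompactSupport.of_support_subset_isCompact (isCompact_cyl δ R) fun p hp => ?_
  rw [mem_cyl]
  refine ⟨?_, ?_⟩ <;> by_contra! hlt
  · exact hp (h1 p hlt.le)
  · exact hp (h2 p hlt.le)

theorem eventuallyEq_zero_of_lt_norm_snd {f : Pt → ℝ} {R : ℝ}
    (h2 : ∀ p : Pt, R ≤ ‖p.2‖ → f p = 0) {p : Pt} (hp : R < ‖p.2‖) : f =ᶠ[𝓝 p] fun _ => 0 := by
  filter_upwards [(isOpen_lt continuous_const continuous_snd.norm).mem_nhds hp] with q hq
  exact h2 q (le_of_lt hq)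

theorem contDiff_of_contDiffAt_of_eq_zero {f : Pt → ℝ} {R K : ℝ} (hRK : R < K)
    (h1 : ∀ p : Pt, ‖p.2‖ < K → ContDiffAt ℝ 1 f p)
    (h2 : ∀ p : Pt, R ≤ ‖p.2‖ → f p = 0) : ContDiff ℝ 1 f := by
  rw [contDiff_iff_contDiffAt]
  intro p
  rcases lt_or_ge ‖p.2‖ K with hp | hp
  · exact h1 p hp
  · exact contDiffAt_const.congr_of_eventuallyEq
      (eventuallyEq_zero_of_lt_norm_snd h2 (hRK.trans_le hp))

theorem fderiv_eq_zero_of_lt_norm_snd {f : Pt → ℝ} {R : ℝ}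
    (h2 : ∀ p : Pt, R ≤ ‖p.2‖ → f p = 0) {p : Pt} (hp : R < ‖p.2‖) : fderiv ℝ f p = 0 := by
  rw [(eventuallyEq_zero_of_lt_norm_snd h2 hp).fderiv_eq]
  simp

/-- Nonnegative `C²` subsolutions on `{|z| < K}` which vanish for `|Z| ≥ δ`. -/
structure IsNonnegSubsolution (a : Pt → ℝ) (δ K : ℝ) (w : Pt → ℝ) : Prop where
  contDiffAt : ∀ p : Pt, ‖p.2‖ < K → ContDiffAt ℝ 2 w p
  nonneg : ∀ p, 0 ≤ w p
  eq_zero : ∀ p : Pt, δ ≤ ‖p.1‖ → w p = 0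
  subSolAt : ∀ p : Pt, ‖p.2‖ < K → SubSolAt a w p

theorem IsNonnegSubsolution.integrableOn_sq {a w : Pt → ℝ} {δ K r : ℝ}
    (hw : IsNonnegSubsolution a δ K w) (hr : r < K) :
    IntegrableOn (fun p => w p ^ 2) (cyl δ r) := by
  refine ContinuousOn.integrableOn_compact (isCompact_cyl δ r) fun p hp => ?_
  have h := (hw.contDiffAt p ((mem_cyl.1 hp).2.trans_lt hr)).continuousAt
  exact (h.pow 2).continuousWithinAt

theorem ContDiffAt.fderiv_apply_const {w : Pt → ℝ} {p : Pt} (hw : ContDiffAt ℝ 2 w p) (e : Pt) :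
    ContDiffAt ℝ 1 (fun q => fderiv ℝ w q e) p :=
  (hw.fderiv_right (m := 1) (by norm_num)).clm_apply contDiffAt_const

/-- The energy identity in a single direction. -/
theorem energy_identity {c w η : Pt → ℝ} {p : Pt} (e : Pt) (hc : DifferentiableAt ℝ c p)
    (hw : ContDiffAt ℝ 2 w p) (hη : DifferentiableAt ℝ η p) :
    c p * (fderiv ℝ (fun q => η q * w q) p e) ^ 2 = w p ^ 2 * (c p * (fderiv ℝ η p e) ^ 2)
      + fderiv ℝ (fun q => η q ^ 2 * w q * (c q * fderiv ℝ w q e)) p e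
      - η p ^ 2 * w p * fderiv ℝ (fun q => c q * fderiv ℝ w q e) p e := by
  have hw1 : HasFDerivAt w (fderiv ℝ w p) p := (hw.differentiableAt (by norm_num)).hasFDerivAt
  have hF : DifferentiableAt ℝ (fun q => c q * fderiv ℝ w q e) p :=
    hc.mul ((hw.fderiv_apply_const e).differentiableAt one_ne_zero)
  have h1 : HasFDerivAt (fun q => η q * w q) _ p := hη.hasFDerivAt.mul hw1
  have h2 : HasFDerivAt (fun q => η q ^ 2 * w q * (c q * fderiv ℝ w q e)) _ p :=
    ((hη.hasFDerivAt.pow 2).mul hw1).mul hF.hasFDerivAt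
  rw [h1.fderiv, h2.fderiv]
  simp
  ring

theorem sum_energy_le {a w : Pt → ℝ} {η : EuclideanSpace ℝ (Fin 2) → ℝ} {δ K lam : ℝ}
    (hw : IsNonnegSubsolution a δ K w) (ha : ContDiff ℝ 1 a) (hη : ContDiff ℝ 2 η)
    (hla : ∀ p, lam ≤ a p) {p : Pt} (hp : ‖p.2‖ < K) :
    min 1 lam * gradSq (fun q => η q.2 * w q) p ≤
      w p ^ 2 * (a p * ∑ j : Fin 2, (fderiv ℝ η p.2 (EuclideanSpace.single j 1)) ^ 2) +
      (∑ i : Fin 4, fderiv ℝ (fun q => η q.2 ^ 2 * w q * (1 * fderiv ℝ w q (dirZ i))) p (dirZ i) +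
       ∑ j : Fin 2, fderiv ℝ (fun q => η q.2 ^ 2 * w q * (a q * fderiv ℝ w q (dirz j))) p
        (dirz j)) := by
  have hηp : HasFDerivAt (fun q : Pt => η q.2) _ p :=
    ((hη.differentiable (by norm_num) p.2).hasFDerivAt).comp p hasFDerivAt_snd
  have hZ := fun i : Fin 4 => energy_identity (c := fun _ => 1) (dirZ i)
    (differentiableAt_const 1) (hw.contDiffAt p hp) hηp.differentiableAt
  have hz := fun j : Fin 2 => energy_identity (c := a) (dirz j)
    (ha.differentiable one_ne_zero p) (hw.contDiffAt p hp) hηp.differentiableAt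
  have eZ : ∀ i, fderiv ℝ (fun q : Pt => η q.2) p (dirZ i) = 0 := fun i => by
    rw [hηp.fderiv]; simp [dirZ]
  have ez : ∀ j, fderiv ℝ (fun q : Pt => η q.2) p (dirz j) =
      fderiv ℝ η p.2 (EuclideanSpace.single j 1) := fun j => by
    rw [hηp.fderiv]; simp [dirz]
  have sZ := Finset.sum_congr rfl fun i (_ : i ∈ Finset.univ) => hZ i
  have sz := Finset.sum_congr rfl fun j (_ : j ∈ Finset.univ) => hz j
  simp only [eZ, ez, Finset.sum_add_distrib, Finset.sum_sub_distrib, ← Finset.mul_sum] at sZ sz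
  have hsub := mul_nonneg (mul_nonneg (sq_nonneg (η p.2)) (hw.nonneg p)) (hw.subSolAt p hp)
  unfold gradSq
  rw [mul_add]
  have m1 : min 1 lam * ∑ i : Fin 4, (fderiv ℝ (fun q : Pt => η q.2 * w q) p (dirZ i)) ^ 2
      ≤ 1 * ∑ i : Fin 4, (fderiv ℝ (fun q : Pt => η q.2 * w q) p (dirZ i)) ^ 2 :=
    mul_le_mul_of_nonneg_right (min_le_left _ _) (by positivity)
  have m2 : min 1 lam * ∑ i : Fin 2, (fderiv ℝ (fun q : Pt => η q.2 * w q) p (dirz i)) ^ 2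
      ≤ a p * ∑ i : Fin 2, (fderiv ℝ (fun q : Pt => η q.2 * w q) p (dirz i)) ^ 2 :=
    mul_le_mul_of_nonneg_right ((min_le_right _ _).trans (hla p)) (by positivity)
  simp only [one_mul] at *
  simp only [ne_eq, OfNat.ofNat_ne_zero, not_false_eq_true, zero_pow, mul_zero,
    Finset.sum_const_zero, zero_add] at sZ
  linarith

/-- Caccioppoli's inequality with a cutoff in the `ℝ²`-variables. -/
theorem exists_caccioppoli {lam Lam : ℝ} (hlam : 0 < lam) (hLam : lam ≤ Lam) :
    ∃ C > (0 : ℝ), ∀ (δ K : ℝ) (a w : Pt → ℝ), ContDiff ℝ 1 a → (∀ p, lam ≤ a p) →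
      (∀ p, a p ≤ Lam) → IsNonnegSubsolution a δ K w → ∀ r R : ℝ, 0 < r → r < R → R < K →
      ∃ u : Pt → ℝ, ContDiff ℝ 1 u ∧ HasCompactSupport u ∧
        (∀ p : Pt, δ ≤ ‖p.1‖ → u p = 0) ∧ (∀ p : Pt, ‖p.2‖ ≤ r → u p = w p) ∧
        ∫ p, gradSq u p ≤
          C / (R - r) ^ 2 * ((∫ p in cyl δ R, w p ^ 2) - ∫ p in cyl δ r, w p ^ 2) := by
  obtain ⟨M, hM, hcut⟩ := exists_cutoff
  have hm : 0 < min 1 lam := lt_min one_pos hlam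
  have hLam0 : 0 < Lam := hlam.trans_le hLam
  refine ⟨2 * Lam * M ^ 2 / min 1 lam, by positivity, ?_⟩
  intro δ K a w ha hla haL hw r R hr hrR hRK
  obtain ⟨η, hη, hone, hzero, hd1, hd0, hdb⟩ := hcut r R hr hrR
  have hηs : ∀ p : Pt, ContDiffAt ℝ 1 (fun q : Pt => η q.2) p := fun p =>
    ((hη.comp contDiff_snd).of_le (by norm_num)).contDiffAt
  have hw1 : ∀ p : Pt, ‖p.2‖ < K → ContDiffAt ℝ 1 w p := fun p hp =>
    (hw.contDiffAt p hp).of_le (by norm_num)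
  have hu0 : ∀ p : Pt, R ≤ ‖p.2‖ → η p.2 * w p = 0 := fun p hp => by rw [hzero _ hp, zero_mul]
  have hu0' : ∀ p : Pt, δ ≤ ‖p.1‖ → η p.2 * w p = 0 := fun p hp => by
    rw [hw.eq_zero p hp, mul_zero]
  have hu : ContDiff ℝ 1 (fun q : Pt => η q.2 * w q) :=
    contDiff_of_contDiffAt_of_eq_zero hRK (fun p hp => (hηs p).mul (hw1 p hp)) hu0
  have huc : HasCompactSupport (fun q : Pt => η q.2 * w q) :=
    hasCompactSupport_of_eq_zero hu0' hu0
  have hG0 : ∀ (c : Pt → ℝ) (e p : Pt), R ≤ ‖p.2‖ →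
      η p.2 ^ 2 * w p * (c p * fderiv ℝ w p e) = 0 := fun c e p hp => by simp [hzero _ hp]
  have hG : ∀ (c : Pt → ℝ), ContDiff ℝ 1 c → ∀ e : Pt,
      ContDiff ℝ 1 (fun q : Pt => η q.2 ^ 2 * w q * (c q * fderiv ℝ w q e)) := fun c hc e =>
    contDiff_of_contDiffAt_of_eq_zero hRK (fun p hp => (((hηs p).pow 2).mul (hw1 p hp)).mul
      (hc.contDiffAt.mul ((hw.contDiffAt p hp).fderiv_apply_const e))) (hG0 c e)
  have hGc : ∀ (c : Pt → ℝ) (e : Pt),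
      HasCompactSupport (fun q : Pt => η q.2 ^ 2 * w q * (c q * fderiv ℝ w q e)) := fun c e =>
    hasCompactSupport_of_eq_zero (δ := δ) (fun p hp => by simp [hw.eq_zero p hp]) (hG0 c e)
  refine ⟨fun q => η q.2 * w q, hu, huc, hu0',
    fun p hp => by simp [hone _ hp], ?_⟩
  have hρ : 0 < R - r := sub_pos.2 hrR
  set B := 2 * Lam * (M / (R - r)) ^ 2 with hB
  have hB0 : 0 ≤ B := by positivity
  let Ind : Pt → ℝ := (cyl δ R \ cyl δ r).indicator fun p => B * w p ^ 2
  let DG : Pt → ℝ := fun p =>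
    ∑ i : Fin 4, fderiv ℝ (fun q => η q.2 ^ 2 * w q * (1 * fderiv ℝ w q (dirZ i))) p (dirZ i) +
    ∑ j : Fin 2, fderiv ℝ (fun q => η q.2 ^ 2 * w q * (a q * fderiv ℝ w q (dirz j))) p (dirz j)
  have hInd0 : ∀ p, 0 ≤ Ind p := fun p =>
    indicator_nonneg (fun q _ => mul_nonneg hB0 (sq_nonneg _)) p
  have hcoef : ∀ p, w p ^ 2 *
      (a p * ∑ j : Fin 2, (fderiv ℝ η p.2 (EuclideanSpace.single j 1)) ^ 2) ≤ Ind p := by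
    intro p
    by_cases h1 : δ ≤ ‖p.1‖
    · simpa [hw.eq_zero p h1] using hInd0 p
    by_cases h2 : ‖p.2‖ ≤ r
    · simpa [hd1 _ h2] using hInd0 p
    by_cases h3 : R ≤ ‖p.2‖
    · simpa [hd0 _ h3] using hInd0 p
    push Not at h1 h2 h3
    have hmem : p ∈ cyl δ R \ cyl δ r :=
      ⟨mem_cyl.2 ⟨h1.le, h3.le⟩, fun h => (mem_cyl.1 h).2.not_gt h2⟩
    have hj : ∀ j : Fin 2, (fderiv ℝ η p.2 (EuclideanSpace.single j 1)) ^ 2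
        ≤ (M / (R - r)) ^ 2 := fun j => by
      have := (fderiv ℝ η p.2).le_opNorm (EuclideanSpace.single j (1 : ℝ))
      rw [PiLp.norm_single, norm_one, mul_one, Real.norm_eq_abs] at this
      rw [← sq_abs]
      exact pow_le_pow_left₀ (abs_nonneg _) (this.trans (hdb _)) 2
    have hsum : ∑ j : Fin 2, (fderiv ℝ η p.2 (EuclideanSpace.single j 1)) ^ 2
        ≤ 2 * (M / (R - r)) ^ 2 := by
      simpa using Finset.sum_le_card_nsmul Finset.univ _ _ (fun j _ => hj j)
    have := mul_le_mul (haL p) hsum (by positivity) hLam0.le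
    simp only [Ind, indicator_of_mem hmem]
    nlinarith [sq_nonneg (w p), mul_le_mul_of_nonneg_left this (sq_nonneg (w p))]
  have hpt : ∀ p, min 1 lam * gradSq (fun q => η q.2 * w q) p ≤ Ind p + DG p := by
    intro p
    rcases lt_or_ge ‖p.2‖ K with hp | hp
    · exact (sum_energy_le hw ha hη hla hp).trans (by gcongr; exact hcoef p)
    · have hp' := hRK.trans_le hp
      have e1 : gradSq (fun q => η q.2 * w q) p = 0 := by
        simp [gradSq, fderiv_eq_zero_of_lt_norm_snd hu0 hp']
      have e2 : DG p = 0 := by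
        have h1 := fun i => fderiv_eq_zero_of_lt_norm_snd (hG0 (fun _ => 1) (dirZ i)) hp'
        have h2 := fun j => fderiv_eq_zero_of_lt_norm_snd (hG0 a (dirz j)) hp'
        simp only [DG, h1, h2]
        simp
      rw [e1, e2, mul_zero, add_zero]
      exact hInd0 p
  have hIntR := hw.integrableOn_sq hRK
  have hmeas : ∀ ρ, MeasurableSet (cyl δ ρ) := fun ρ => (isCompact_cyl δ ρ).measurableSet
  have hIndI : Integrable Ind :=
    IntegrableOn.integrable_indicator ((hIntR.mono_set sdiff_subset).const_mul B)
      ((hmeas R).diff (hmeas r))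
  have hZI := fun i : Fin 4 => integrable_fderiv_apply
    (hG (fun _ => 1) contDiff_const (dirZ i)) (hGc _ _) (dirZ i)
  have hzI := fun j : Fin 2 => integrable_fderiv_apply (hG a ha (dirz j)) (hGc _ _) (dirz j)
  have hZS := integrable_finsetSum Finset.univ fun i _ => hZI i
  have hzS := integrable_finsetSum Finset.univ fun j _ => hzI j
  have hDGI : Integrable DG := hZS.add hzS
  have hDG0 : ∫ p, DG p = 0 := by
    simp only [DG]
    rw [integral_add hZS hzS, integral_finsetSum _ fun i _ => hZI i,
      integral_finsetSum _ fun j _ => hzI j,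
      Finset.sum_eq_zero fun i _ => integral_fderiv_apply_eq_zero
        (hG (fun _ => 1) contDiff_const (dirZ i)) (hGc _ _) (dirZ i),
      Finset.sum_eq_zero fun j _ => integral_fderiv_apply_eq_zero
        (hG a ha (dirz j)) (hGc _ _) (dirz j), add_zero]
  have hIndv : ∫ p, Ind p = B * ((∫ p in cyl δ R, w p ^ 2) - ∫ p in cyl δ r, w p ^ 2) := by
    simp only [Ind]
    rw [integral_indicator ((hmeas R).diff (hmeas r)), integral_const_mul,
      setIntegral_sdiff (hmeas r) hIntR (cyl_mono hrR.le)]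
  have hfin := integral_mono ((integrable_gradSq hu huc).const_mul (min 1 lam))
    (hIndI.add hDGI) hpt
  simp only [Pi.add_apply] at hfin
  rw [integral_add hIndI hDGI, hDG0, hIndv, integral_const_mul, add_zero] at hfin
  rw [mul_comm, ← le_div_iff₀ hm] at hfin
  refine hfin.trans (le_of_eq ?_)
  rw [hB]
  field_simp

theorem hasDerivAt_max_zero_pow (n : ℕ) (t : ℝ) :
    HasDerivAt (fun t : ℝ => max t 0 ^ (n + 2)) ((n + 2 : ℕ) * max t 0 ^ (n + 1)) t := by
  refine hasDerivAt_of_hasDerivAt_of_ne' (x := 0) (f := fun t : ℝ => max t 0 ^ (n + 2))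
    (g := fun t : ℝ => ((n + 2 : ℕ) : ℝ) * max t 0 ^ (n + 1)) (fun y hy => ?_)
    (by fun_prop) (by fun_prop) t
  rcases lt_or_gt_of_ne hy with h | h
  · have e : (fun t : ℝ => max t 0 ^ (n + 2)) =ᶠ[𝓝 y] fun _ => 0 := by
      filter_upwards [Iio_mem_nhds h] with z hz
      simp [max_eq_right (mem_Iio.1 hz).le]
    have := (hasDerivAt_const y (0 : ℝ)).congr_of_eventuallyEq e
    simpa [max_eq_right h.le] using this
  · have e : (fun t : ℝ => max t 0 ^ (n + 2)) =ᶠ[𝓝 y] fun t => t ^ (n + 2) := by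
      filter_upwards [Ioi_mem_nhds h] with z hz
      simp [max_eq_left (mem_Ioi.1 hz).le]
    have := (hasDerivAt_pow (n + 2) y).congr_of_eventuallyEq e
    simpa [max_eq_left h.le] using this

theorem contDiff_max_zero_pow_three : ContDiff ℝ 2 fun t : ℝ => max t 0 ^ 3 := by
  have d1 : deriv (fun t : ℝ => max t 0 ^ 3) = fun t => 3 * max t 0 ^ 2 :=
    funext fun t => by simpa using (hasDerivAt_max_zero_pow 1 t).deriv
  have d2 : deriv (fun t : ℝ => max t 0 ^ 2) = fun t => 2 * max t 0 :=
    funext fun t => by simpa using (hasDerivAt_max_zero_pow 0 t).deriv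
  have h2 : ContDiff ℝ 1 fun t : ℝ => max t 0 ^ 2 :=
    contDiff_one_iff_deriv.2 ⟨fun t => (hasDerivAt_max_zero_pow 0 t).differentiableAt, by
      rw [d2]; fun_prop⟩
  have := (contDiff_succ_iff_deriv (n := 1) (f := fun t : ℝ => max t 0 ^ 3)).2
    ⟨fun t => (hasDerivAt_max_zero_pow 1 t).differentiableAt, by simp, by
      rw [d1]; exact contDiff_const.mul h2⟩
  simpa [one_add_one_eq_two] using this

theorem hasFDerivAt_truncation (n : ℕ) (s : ℝ) {v : Pt → ℝ} {p : Pt}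
    (hv : DifferentiableAt ℝ v p) :
    HasFDerivAt (fun x => max (v x - s) 0 ^ (n + 2))
      (((n + 2 : ℕ) * max (v p - s) 0 ^ (n + 1)) • fderiv ℝ v p) p :=
  HasDerivAt.comp_hasFDerivAt (h₂ := fun t : ℝ => max t 0 ^ (n + 2)) p
    (hasDerivAt_max_zero_pow n (v p - s)) (hv.hasFDerivAt.sub_const s)

theorem fderiv_truncation_le {c v : Pt → ℝ} {p : Pt} (s : ℝ) (e : Pt) (hc : DifferentiableAt ℝ c p)
    (hc0 : 0 ≤ c p) (hv : ContDiffAt ℝ 2 v p) :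
    3 * max (v p - s) 0 ^ 2 * fderiv ℝ (fun q => c q * fderiv ℝ v q e) p e ≤
      fderiv ℝ (fun q => c q * fderiv ℝ (fun x => max (v x - s) 0 ^ 3) q e) p e := by
  have hd : ∀ᶠ q in 𝓝 p, DifferentiableAt ℝ v q :=
    (hv.eventually (by simp)).mono fun q hq => hq.differentiableAt (by norm_num)
  have e1 : (fun q => c q * fderiv ℝ (fun x => max (v x - s) 0 ^ 3) q e) =ᶠ[𝓝 p]
      fun q => 3 * max (v q - s) 0 ^ 2 * (c q * fderiv ℝ v q e) := by
    filter_upwards [hd] with q hq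
    rw [(hasFDerivAt_truncation 1 s hq).fderiv]
    simp
    ring
  have hF : DifferentiableAt ℝ (fun q => c q * fderiv ℝ v q e) p :=
    hc.mul ((hv.fderiv_apply_const e).differentiableAt one_ne_zero)
  have h2 := hasFDerivAt_truncation 0 s (hv.differentiableAt (by norm_num))
  have h3 : HasFDerivAt (fun q => 3 * max (v q - s) 0 ^ 2 * (c q * fderiv ℝ v q e)) _ p :=
    (h2.const_mul 3).mul hF.hasFDerivAt
  rw [e1.fderiv_eq, h3.fderiv]
  have hnn : 0 ≤ max (v p - s) 0 * c p * (fderiv ℝ v p e) ^ 2 := by positivity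
  simp
  nlinarith

theorem SubSolAt.truncation {a v : Pt → ℝ} {p : Pt} (s : ℝ) (h : SubSolAt a v p)
    (ha : DifferentiableAt ℝ a p) (ha0 : 0 ≤ a p) (hv : ContDiffAt ℝ 2 v p) :
    SubSolAt a (fun q => max (v q - s) 0 ^ 3) p := by
  have hZ := Finset.sum_le_sum fun i (_ : i ∈ (Finset.univ : Finset (Fin 4))) =>
    fderiv_truncation_le s (dirZ i) (differentiableAt_const (1 : ℝ)) zero_le_one hv
  have hz := Finset.sum_le_sum fun j (_ : j ∈ (Finset.univ : Finset (Fin 2))) =>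
    fderiv_truncation_le s (dirz j) ha ha0 hv
  simp only [one_mul, ← Finset.mul_sum] at hZ hz
  have := mul_nonneg (by positivity : 0 ≤ 3 * max (v p - s) 0 ^ 2) h
  rw [mul_add] at this
  exact this.trans (add_le_add hZ hz)

theorem SubSolAt.congr_of_eventuallyEq {a v w : Pt → ℝ} {p : Pt} (h : SubSolAt a v p)
    (hvw : w =ᶠ[𝓝 p] v) : SubSolAt a w p := by
  have e : ∀ d : Pt, (fun q => fderiv ℝ w q d) =ᶠ[𝓝 p] fun q => fderiv ℝ v q d := fun d =>
    (hvw.fderiv (𝕜 := ℝ)).mono fun q hq => by simp only [hq]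
  unfold SubSolAt at h ⊢
  have e1 : ∀ i, fderiv ℝ (fun q => fderiv ℝ w q (dirZ i)) p
      = fderiv ℝ (fun q => fderiv ℝ v q (dirZ i)) p := fun i => (e (dirZ i)).fderiv_eq
  have e2 : ∀ j, fderiv ℝ (fun q => a q * fderiv ℝ w q (dirz j)) p
      = fderiv ℝ (fun q => a q * fderiv ℝ v q (dirz j)) p := fun j =>
    ((EventuallyEq.refl _ a).mul (e (dirz j))).fderiv_eq
  simpa only [e1, e2] using h

theorem isOpen_annCyl (ε δ K : ℝ) : IsOpen (annCyl ε δ K) :=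
  ((isOpen_lt continuous_const continuous_fst.norm).inter
    (isOpen_lt continuous_fst.norm continuous_const)).inter
    (isOpen_lt continuous_snd.norm continuous_const)

open Classical in
/-- Extension by zero outside of the annulus-cylinder. -/
def zeroExt (ε δ K : ℝ) (v : Pt → ℝ) (p : Pt) : ℝ := if p ∈ annCyl ε δ K then v p else 0

theorem zeroExt_le_one {ε δ K : ℝ} {v : Pt → ℝ}
    (hv : ∀ p ∈ closure (annCyl ε δ K), 0 ≤ v p ∧ v p ≤ 1) (p : Pt) : zeroExt ε δ K v p ≤ 1 := by
  unfold zeroExt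
  split_ifs with h
  · exact (hv p (subset_closure h)).2
  · exact zero_le_one

theorem eventually_zeroExt_lt {ε δ K s : ℝ} {v : Pt → ℝ} (hs : 0 < s)
    (hvc : ContinuousOn v (closure (annCyl ε δ K)))
    (hv0 : ∀ p : Pt, (‖p.1‖ = ε ∨ ‖p.1‖ = δ) → ‖p.2‖ ≤ K → v p = 0)
    {p : Pt} (hpK : ‖p.2‖ < K) (hp : p ∉ annCyl ε δ K) :
    ∀ᶠ q in 𝓝 p, zeroExt ε δ K v q < s := by
  have key : ∀ᶠ q in 𝓝 p, q ∈ annCyl ε δ K → v q < s := by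
    by_cases hcl : p ∈ closure (annCyl ε δ K)
    · have hle : ε ≤ ‖p.1‖ ∧ ‖p.1‖ ≤ δ := by
        refine closure_minimal (t := {q : Pt | ε ≤ ‖q.1‖ ∧ ‖q.1‖ ≤ δ})
          (fun q hq => ⟨hq.1.1.le, hq.1.2.le⟩) ?_ hcl
        exact (isClosed_le continuous_const continuous_fst.norm).inter
          (isClosed_le continuous_fst.norm continuous_const)
      have hb : ‖p.1‖ = ε ∨ ‖p.1‖ = δ := by
        by_contra! hne
        exact hp ⟨⟨lt_of_le_of_ne hle.1 hne.1.symm, lt_of_le_of_ne hle.2 hne.2⟩, hpK⟩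
      have hlt := (hvc p hcl).eventually_lt_const (u := s) (by rwa [hv0 p hb hpK.le])
      filter_upwards [eventually_nhdsWithin_iff.1 hlt] with q hq hqm
      exact hq (subset_closure hqm)
    · filter_upwards [isClosed_closure.isOpen_compl.mem_nhds hcl] with q hq hqm
      exact absurd (subset_closure hqm) hq
  filter_upwards [key] with q hq
  unfold zeroExt
  split_ifs with h
  · exact hq h
  · exact hs

theorem isNonnegSubsolution_truncation {ε δ K s : ℝ} {a v : Pt → ℝ} (hs : 0 < s)
    (ha : ContDiff ℝ 1 a) (ha0 : ∀ p, 0 ≤ a p)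
    (hvc : ContinuousOn v (closure (annCyl ε δ K))) (hv2 : ContDiffOn ℝ 2 v (annCyl ε δ K))
    (hsub : ∀ p ∈ annCyl ε δ K, SubSolAt a v p)
    (hv0 : ∀ p : Pt, (‖p.1‖ = ε ∨ ‖p.1‖ = δ) → ‖p.2‖ ≤ K → v p = 0) :
    IsNonnegSubsolution a δ K (fun p => max (zeroExt ε δ K v p - s) 0 ^ 3) := by
  have hin : ∀ p ∈ annCyl ε δ K, (fun p => max (zeroExt ε δ K v p - s) 0 ^ 3) =ᶠ[𝓝 p]
      fun p => max (v p - s) 0 ^ 3 := fun p hp => by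
    filter_upwards [(isOpen_annCyl ε δ K).mem_nhds hp] with q hq
    simp [zeroExt, hq]
  have hout : ∀ p : Pt, ‖p.2‖ < K → p ∉ annCyl ε δ K →
      (fun p => max (zeroExt ε δ K v p - s) 0 ^ 3) =ᶠ[𝓝 p] fun _ => 0 := fun p hpK hp => by
    filter_upwards [eventually_zeroExt_lt hs hvc hv0 hpK hp] with q hq
    rw [max_eq_right (by linarith)]
    norm_num
  have hvp : ∀ p ∈ annCyl ε δ K, ContDiffAt ℝ 2 v p := fun p hp =>
    hv2.contDiffAt ((isOpen_annCyl ε δ K).mem_nhds hp)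
  refine ⟨fun p hpK => ?_, fun p => by positivity, fun p hp => ?_, fun p hpK => ?_⟩
  · by_cases hp : p ∈ annCyl ε δ K
    · exact (contDiff_max_zero_pow_three.contDiffAt.comp p
        ((hvp p hp).sub contDiffAt_const)).congr_of_eventuallyEq (hin p hp)
    · exact contDiffAt_const.congr_of_eventuallyEq (hout p hpK hp)
  · have hn : p ∉ annCyl ε δ K := fun h => hp.not_gt h.1.2
    simp [zeroExt, hn, hs.le]
  · by_cases hp : p ∈ annCyl ε δ K
    · exact ((hsub p hp).truncation s (ha.differentiable one_ne_zero p) (ha0 p)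
        (hvp p hp)).congr_of_eventuallyEq (hin p hp)
    · refine SubSolAt.congr_of_eventuallyEq (v := fun _ => 0) ?_ (hout p hpK hp)
      simp [SubSolAt]

/-- The `L²`-mass of a subsolution decays geometrically from `{|z| < r + δ}` to `{|z| < r}`. -/
theorem exists_mass_decay {lam Lam : ℝ} (hlam : 0 < lam) (hLam : lam ≤ Lam) :
    ∃ β > (0 : ℝ), ∀ (δ K : ℝ) (a w : Pt → ℝ), 0 < δ → ContDiff ℝ 1 a → (∀ p, lam ≤ a p) →
      (∀ p, a p ≤ Lam) → IsNonnegSubsolution a δ K w → ∀ n : ℕ, (n + 1) * δ < K →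
      ∫ p in cyl δ δ, w p ^ 2 ≤
        Real.exp (-β * n) * ∫ p in cyl δ ((n + 1) * δ), w p ^ 2 := by
  obtain ⟨C, hC, hcac⟩ := exists_caccioppoli hlam hLam
  set θ := 4 * C / (1 + 4 * C) with hθ
  have hθ0 : 0 < θ := by positivity
  have hθ1 : θ < 1 := by rw [hθ, div_lt_one (by positivity)]; linarith
  refine ⟨-Real.log θ, neg_pos.2 (Real.log_neg hθ0 hθ1), ?_⟩
  intro δ K a w hδ ha hla haL hw n
  have hexp : Real.exp (-(-Real.log θ) * n) = θ ^ n := by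
    rw [neg_neg, mul_comm, Real.exp_nat_mul, Real.exp_log hθ0]
  rw [hexp]
  clear hexp
  induction n with
  | zero => intro _; simp
  | succ n ih =>
    intro hn
    push_cast at hn ⊢
    refine (ih (by linarith)).trans ?_
    rw [pow_succ, mul_assoc]
    gcongr
    obtain ⟨u, hu, huc, huδ, huw, hE⟩ := hcac δ K a w ha hla haL hw ((n + 1) * δ)
      ((n + 1 + 1) * δ) (by positivity) (by linarith) hn
    set I := ∫ p in cyl δ ((n + 1) * δ), w p ^ 2
    set J := ∫ p in cyl δ ((n + 1 + 1) * δ), w p ^ 2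
    have hP := integral_sq_le_gradSq hu huc hδ huδ
    have hI : I ≤ ∫ p, u p ^ 2 := by
      have e : I = ∫ p in cyl δ ((n + 1) * δ), u p ^ 2 :=
        setIntegral_congr_fun (isCompact_cyl _ _).measurableSet fun p hp => by
          simp only [huw p (mem_cyl.1 hp).2]
      rw [e]
      exact setIntegral_le_integral
        ((hu.continuous.memLp_of_hasCompactSupport (p := 2) huc).integrable_sq)
        (Eventually.of_forall fun p => sq_nonneg _)
    have hδ2 : 4 * δ ^ 2 * (C / ((n + 1 + 1) * δ - (n + 1) * δ) ^ 2 * (J - I))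
        = 4 * C * (J - I) := by
      have : ((n : ℝ) + 1 + 1) * δ - (n + 1) * δ = δ := by ring
      rw [this]
      field_simp
    have hIJ : I ≤ 4 * C * (J - I) := by
      rw [← hδ2]
      exact hI.trans (hP.trans (by gcongr))
    rw [hθ, div_mul_eq_mul_div, le_div_iff₀ (by positivity)]
    linarith

/-- The De Giorgi step between two levels and two radii. -/
theorem exists_deGiorgi_step {lam Lam : ℝ} (hlam : 0 < lam) (hLam : lam ≤ Lam) :
    ∃ C > (0 : ℝ), ∀ (δ K : ℝ) (a f : Pt → ℝ), ContDiff ℝ 1 a → (∀ p, lam ≤ a p) →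
      (∀ p, a p ≤ Lam) →
      (∀ s, 0 < s → IsNonnegSubsolution a δ K (fun p => max (f p - s) 0 ^ 3)) →
      ∀ k l r R : ℝ, 0 < k → k < l → 0 < r → r < R → R < K →
      (∫ p in cyl δ r, (max (f p - l) 0 ^ 3) ^ 2) ^ 2 ≤
        C / ((l - k) ^ 6 * (R - r) ^ 6) * (∫ p in cyl δ R, (max (f p - k) 0 ^ 3) ^ 2) ^ 3 := by
  obtain ⟨C, hC, hcac⟩ := exists_caccioppoli hlam hLam
  obtain ⟨S, hS, hsob⟩ := exists_sobolev_const
  refine ⟨S * C ^ 3, by positivity, ?_⟩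
  intro δ K a f ha hla haL hf k l r R hk hkl hr hrR hRK
  obtain ⟨u, hu, huc, huδ, huw, hE⟩ := hcac δ K a _ ha hla haL (hf k hk) r R hr hrR hRK
  set A := ∫ p in cyl δ R, (max (f p - k) 0 ^ 3) ^ 2
  set B := ∫ p in cyl δ r, (max (f p - l) 0 ^ 3) ^ 2
  have hB0 : 0 ≤ B := integral_nonneg fun p => by positivity
  have hd : 0 < l - k := sub_pos.2 hkl
  have hρ : 0 < R - r := sub_pos.2 hrR
  have hu3 : Integrable fun p => |u p| ^ 3 := by
    simpa using (hu.continuous.memLp_of_hasCompactSupport (p := 3) huc).integrable_norm_pow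
      (by norm_num)
  have hBu : (l - k) ^ 3 * B ≤ ∫ p, |u p| ^ 3 := by
    rw [← integral_const_mul]
    refine (setIntegral_mono_on (((hf l (hk.trans hkl)).integrableOn_sq
      (hrR.trans hRK)).const_mul _) hu3.integrableOn (isCompact_cyl δ r).measurableSet
      fun p hp => ?_).trans
      (setIntegral_le_integral hu3 (Eventually.of_forall fun p => by positivity))
    rw [huw p (mem_cyl.1 hp).2, abs_of_nonneg (by positivity)]
    rcases le_or_gt (f p) l with h | h
    · rw [max_eq_right (sub_nonpos.2 h)]
      simp only [ne_eq, OfNat.ofNat_ne_zero, not_false_eq_true, zero_pow, mul_zero]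
      positivity
    · rw [max_eq_left (sub_pos.2 h).le, max_eq_left (by linarith)]
      have h1 : (l - k) ^ 3 ≤ (f p - k) ^ 3 := by gcongr
      have h2 : ((f p - l) ^ 3) ^ 2 ≤ ((f p - k) ^ 3) ^ 2 := by
        have : 0 ≤ f p - l := by linarith
        gcongr
      calc (l - k) ^ 3 * ((f p - l) ^ 3) ^ 2 ≤ (f p - k) ^ 3 * ((f p - k) ^ 3) ^ 2 := by
            gcongr
            have : 0 ≤ f p - k := by linarith
            positivity
        _ = ((f p - k) ^ 3) ^ 3 := by ring
  have hg0 : 0 ≤ ∫ p, gradSq u p := integral_nonneg (gradSq_nonneg u)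
  have hE' : ∫ p, gradSq u p ≤ C / (R - r) ^ 2 * A := by
    refine hE.trans ?_
    gcongr
    exact sub_le_self _ (integral_nonneg fun p => by positivity)
  rw [div_mul_eq_mul_div, le_div_iff₀ (by positivity)]
  have h6 : ((l - k) ^ 3 * B) ^ 2 ≤ S * (C / (R - r) ^ 2 * A) ^ 3 :=
    (pow_le_pow_left₀ (by positivity) hBu 2).trans ((hsob u hu huc).trans (by gcongr))
  calc B ^ 2 * ((l - k) ^ 6 * (R - r) ^ 6) = ((l - k) ^ 3 * B) ^ 2 * (R - r) ^ 6 := by ring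
    _ ≤ S * (C / (R - r) ^ 2 * A) ^ 3 * (R - r) ^ 6 := by gcongr
    _ = S * C ^ 3 * A ^ 3 := by field_simp

theorem le_mul_inv_pow_of_sq_le {C D b : ℝ} (hC : 0 < C) (hD : 0 < D) (hb : 0 < b) {A : ℕ → ℝ}
    (hA : ∀ n, 0 ≤ A n) (hstep : ∀ n, A (n + 1) ^ 2 ≤ C * b ^ (n + 2) / D * A n ^ 3)
    (h0 : A 0 ≤ 1 / (C * b ^ 4) * D) (n : ℕ) : A n ≤ 1 / (C * b ^ 4) * D * (b⁻¹) ^ n := by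
  induction n with
  | zero => simpa using h0
  | succ n ih =>
    refine le_of_sq_le_sq ?_ (by positivity)
    refine (hstep n).trans ?_
    calc C * b ^ (n + 2) / D * A n ^ 3
        ≤ C * b ^ (n + 2) / D * (1 / (C * b ^ 4) * D * (b⁻¹) ^ n) ^ 3 := by
          have := hA n
          gcongr
      _ = (1 / (C * b ^ 4) * D * (b⁻¹) ^ (n + 1)) ^ 2 := by
          rw [inv_pow, inv_pow]
          field_simp
          ring

/-- Local boundedness: a small `L²`-mass of the truncation at level `h / 2` bounds `f` by `h`. -/
theorem exists_local_bound {lam Lam : ℝ} (hlam : 0 < lam) (hLam : lam ≤ Lam) :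
    ∃ c > (0 : ℝ), ∀ (δ K : ℝ) (a f : Pt → ℝ), 0 < δ → δ < K → ContDiff ℝ 1 a →
      (∀ p, lam ≤ a p) → (∀ p, a p ≤ Lam) →
      (∀ s, 0 < s → IsNonnegSubsolution a δ K (fun p => max (f p - s) 0 ^ 3)) →
      ∀ h : ℝ, 0 < h → ∫ p in cyl δ δ, (max (f p - h / 2) 0 ^ 3) ^ 2 ≤ c * (h ^ 6 * δ ^ 6) →
      ∀ p : Pt, ‖p.2‖ < δ / 2 → f p ≤ h := by
  obtain ⟨C, hC, hst⟩ := exists_deGiorgi_step hlam hLam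
  refine ⟨1 / (C * 4096 ^ 4), by positivity, ?_⟩
  intro δ K a f hδ hδK ha hla haL hf h hh h0 p hp
  let t : ℕ → ℝ := fun n => (2⁻¹ : ℝ) ^ n
  have ht0 : ∀ n, 0 < t n := fun n => by positivity
  have ht1 : ∀ n, t n ≤ 1 := fun n => pow_le_one₀ (by norm_num) (by norm_num)
  have hts : ∀ n, t (n + 1) = t n / 2 := fun n => by simp only [t, pow_succ]; ring
  let k : ℕ → ℝ := fun n => h * (1 - t n / 2)
  let r : ℕ → ℝ := fun n => δ / 2 * (1 + t n)
  let A : ℕ → ℝ := fun n => ∫ p in cyl δ (r n), (max (f p - k n) 0 ^ 3) ^ 2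
  have hk0 : ∀ n, 0 < k n := fun n => mul_pos hh (by linarith [ht1 n])
  have hkh : ∀ n, k n ≤ h := fun n => by
    have := mul_pos hh (ht0 n)
    simp only [k]; linarith
  have hr0 : ∀ n, δ / 2 < r n := fun n => by
    have := mul_pos hδ (ht0 n)
    simp only [r]; linarith
  have hrK : ∀ n, r n < K := fun n => by
    have := mul_le_mul_of_nonneg_left (ht1 n) hδ.le
    simp only [r]; linarith
  have hA : ∀ n, A n ≤ 1 / (C * 4096 ^ 4) * (h ^ 6 * δ ^ 6) * ((4096 : ℝ)⁻¹) ^ n := by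
    refine le_mul_inv_pow_of_sq_le hC (by positivity) (by norm_num)
      (fun n => integral_nonneg fun p => by positivity) (fun n => ?_) ?_
    · have ek : k (n + 1) - k n = h * (t n / 4) := by simp only [k, hts]; ring
      have er : r n - r (n + 1) = δ * (t n / 4) := by simp only [r, hts]; ring
      have hpos := ht0 n
      have key := hst δ K a f ha hla haL hf (k n) (k (n + 1)) (r (n + 1)) (r n) (hk0 n)
        (sub_pos.1 (by rw [ek]; positivity)) (by linarith [hr0 (n + 1)])
        (sub_pos.1 (by rw [er]; positivity)) (hrK n)
      rw [ek, er] at key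
      refine key.trans (le_of_eq ?_)
      congr 1
      have e4 : (4096 : ℝ) ^ (n + 2) * (t n / 4) ^ 12 = 1 := by
        have : (4096 : ℝ) ^ n * (t n) ^ 12 = 1 := by
          simp only [t]
          rw [← pow_mul, mul_comm n 12, pow_mul, ← mul_pow]
          norm_num
        rw [pow_add, div_pow]
        linear_combination this
      rw [div_eq_div_iff (by positivity) (by positivity)]
      linear_combination (-(C * h ^ 6 * δ ^ 6)) * e4
    · have e1 : r 0 = δ := by simp only [r, t, pow_zero]; ring
      have e2 : k 0 = h / 2 := by simp only [k, t, pow_zero]; ring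
      simp only [A, e1, e2]
      exact h0
  have hlim : Tendsto (fun n => 1 / (C * 4096 ^ 4) * (h ^ 6 * δ ^ 6) * ((4096 : ℝ)⁻¹) ^ n)
      atTop (𝓝 0) := by
    have := (tendsto_pow_atTop_nhds_zero_of_lt_one (r := (4096 : ℝ)⁻¹) (by norm_num)
      (by norm_num)).const_mul (1 / (C * 4096 ^ 4) * (h ^ 6 * δ ^ 6))
    rwa [mul_zero] at this
  by_contra! hlt
  let g : Pt → ℝ := fun p => max (f p - h) 0 ^ 3
  have hgp : 0 < g p := pow_pos (lt_max_of_lt_left (sub_pos.2 hlt)) 3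
  have hp1 : ‖p.1‖ < δ := by
    by_contra! hge
    exact hgp.ne' ((hf h hh).eq_zero p hge)
  have hgc : ContinuousAt g p := ((hf h hh).contDiffAt p (by linarith)).continuousAt
  have hev : ∀ᶠ q in 𝓝 p, g p / 2 < g q ∧ ‖q.1‖ < δ ∧ ‖q.2‖ < δ / 2 := by
    filter_upwards [hgc.eventually_const_lt (half_lt_self hgp),
      (isOpen_lt continuous_fst.norm continuous_const).mem_nhds hp1,
      (isOpen_lt continuous_snd.norm continuous_const).mem_nhds hp] with q h1 h2 h3
    exact ⟨h1, h2, h3⟩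
  obtain ⟨N, hN, hNo, hpN⟩ := eventually_nhds_iff.1 hev
  have hNc : ∀ n, N ⊆ cyl δ (r n) := fun n q hq =>
    mem_cyl.2 ⟨(hN q hq).2.1.le, (hN q hq).2.2.le.trans (hr0 n).le⟩
  have hNfin : volume N ≠ ⊤ :=
    ((measure_mono (hNc 0)).trans_lt (isCompact_cyl δ (r 0)).measure_lt_top).ne
  have hNpos : 0 < volume.real N :=
    ENNReal.toReal_pos (hNo.measure_pos volume ⟨p, hpN⟩).ne' hNfin
  have hlow : ∀ n, volume.real N * (g p / 2) ^ 2 ≤ A n := fun n => by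
    have hint := (hf (k n) (hk0 n)).integrableOn_sq (hrK n)
    calc volume.real N * (g p / 2) ^ 2 = ∫ _ in N, (g p / 2) ^ 2 := by simp
      _ ≤ ∫ q in N, (max (f q - k n) 0 ^ 3) ^ 2 := by
          refine setIntegral_mono_on (integrableOn_const hNfin) (hint.mono_set (hNc n))
            hNo.measurableSet fun q hq => ?_
          refine pow_le_pow_left₀ (by positivity) ((hN q hq).1.le.trans ?_) 2
          have := hkh n
          simp only [g]
          gcongr
      _ ≤ A n := setIntegral_mono_set hint (Eventually.of_forall fun q => by positivity)
          (hNc n).eventuallyLE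
  have := ge_of_tendsto' hlim fun n => (hlow n).trans (hA n)
  have hpos : 0 < volume.real N * (g p / 2) ^ 2 := by positivity
  linarith

theorem exists_volume_cyl_le : ∃ c > (0 : ℝ), ∀ δ r : ℝ, 0 < δ → δ ≤ r →
    volume.real (cyl δ r) ≤ c * r ^ 6 := by
  refine ⟨volume.real (Metric.ball (0 : Pt) 1),
    ENNReal.toReal_pos (Metric.measure_ball_pos _ _ one_pos).ne' measure_ball_lt_top.ne, ?_⟩
  intro δ r hδ hr
  have hsub : cyl δ r ⊆ Metric.closedBall (0 : Pt) r := fun p hp => by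
    rw [mem_cyl] at hp
    rw [mem_closedBall_zero_iff, Prod.norm_def]
    exact max_le (hp.1.trans hr) hp.2
  refine (measureReal_mono hsub measure_closedBall_lt_top.ne).trans (le_of_eq ?_)
  have hr0 : 0 ≤ r := by linarith
  rw [Measure.real, Measure.addHaar_closedBall _ _ hr0, ENNReal.toReal_mul,
    ENNReal.toReal_ofReal (by positivity), mul_comm]
  simp [Measure.real]


/-- Decay estimate on the annulus-cylinder: a subsolution of the uniformly elliptic
divergence-form operator, vanishing on the annular part of the boundary and with
`0 ≤ v ≤ 1`, is bounded by `C e^{−γK/δ}` on the inner cylinder `{|z| < δ/2}`. -/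
theorem stmt18 (lam Lam : ℝ) (hlam : 0 < lam) (hLam : lam ≤ Lam) :
    ∃ C > (0:ℝ), ∃ γ > (0:ℝ),
      ∀ ε δ K : ℝ, 0 < ε → ε < δ → 2 * δ ≤ K →
      ∀ a v : EuclideanSpace ℝ (Fin 4) × EuclideanSpace ℝ (Fin 2) → ℝ,
        ContDiff ℝ 1 a → (∀ p, lam ≤ a p) → (∀ p, a p ≤ Lam) →
        ContinuousOn v (closure (annCyl ε δ K)) →
        ContDiffOn ℝ 2 v (annCyl ε δ K) →
        (∀ p ∈ closure (annCyl ε δ K), 0 ≤ v p ∧ v p ≤ 1) →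
        (∀ p ∈ annCyl ε δ K, SubSolAt a v p) →
        (∀ p : EuclideanSpace ℝ (Fin 4) × EuclideanSpace ℝ (Fin 2),
          (‖p.1‖ = ε ∨ ‖p.1‖ = δ) → ‖p.2‖ ≤ K → v p = 0) →
        ∀ p : EuclideanSpace ℝ (Fin 4) × EuclideanSpace ℝ (Fin 2),
          ε < ‖p.1‖ → ‖p.1‖ < δ → ‖p.2‖ < δ / 2 →
            v p ≤ C * Real.exp (-γ * K / δ) := by
  obtain ⟨β, hβ, hdecay⟩ := exists_mass_decay hlam hLam
  obtain ⟨c, hc, hbound⟩ := exists_local_bound hlam hLam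
  obtain ⟨V, hV, hvol⟩ := exists_volume_cyl_le
  set D := Real.exp (3 * β) * V * (720 * (2 / β) ^ 6) / c with hD
  have hD0 : 0 < D := by positivity
  refine ⟨1 + D, by positivity, β / 12, by positivity, ?_⟩
  intro ε δ K hε hεδ hδK a v ha hla haL hvc hv2 hv01 hsub hv0 p hp1 hp2 hp3
  have hδ : 0 < δ := hε.trans hεδ
  have ha0 : ∀ p, 0 ≤ a p := fun p => hlam.le.trans (hla p)
  have hf : ∀ s, 0 < s → IsNonnegSubsolution a δ K
      (fun p => max (zeroExt ε δ K v p - s) 0 ^ 3) := fun s hs =>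
    isNonnegSubsolution_truncation hs ha ha0 hvc hv2 hsub hv0
  obtain ⟨x, rfl⟩ : ∃ x, K = x * δ := ⟨K / δ, by field_simp⟩
  have hx : 2 ≤ x := le_of_mul_le_mul_right hδK hδ
  set h := (1 + D) * Real.exp (-(β / 12) * (x * δ) / δ) with hh
  have hexp : -(β / 12) * (x * δ) / δ = -(β / 12) * x := by field_simp
  have hh0 : 0 < h := by positivity
  have hpQ : p ∈ annCyl ε δ (x * δ) := ⟨⟨hp1, hp2⟩, by linarith⟩
  have hfp : zeroExt ε δ (x * δ) v p = v p := by simp [zeroExt, hpQ]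
  rw [← hfp]
  refine hbound δ (x * δ) a _ hδ (by linarith) ha hla haL hf h hh0 ?_ p hp3
  obtain ⟨n, hn⟩ : ∃ n, ⌊x⌋₊ = n + 2 := Nat.exists_eq_add_of_le' (Nat.le_floor (mod_cast hx))
  have hn1 : (n : ℝ) + 2 ≤ x := by
    have := Nat.floor_le (zero_le_two.trans hx)
    rw [hn] at this
    exact_mod_cast this
  have hn2 : x < n + 3 := by
    have := Nat.lt_floor_add_one x
    rw [hn] at this
    push_cast at this
    linarith
  have hnK : ((n : ℝ) + 1) * δ < x * δ := mul_lt_mul_of_pos_right (by linarith) hδ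
  have hmass : ∫ q in cyl δ ((n + 1) * δ), (max (zeroExt ε δ (x * δ) v q - h / 2) 0 ^ 3) ^ 2 ≤
      V * (x * δ) ^ 6 :=
    calc ∫ q in cyl δ ((n + 1) * δ), (max (zeroExt ε δ (x * δ) v q - h / 2) 0 ^ 3) ^ 2
        ≤ ∫ _ in cyl δ ((n + 1) * δ), (1 : ℝ) := by
          refine setIntegral_mono_on ((hf _ (half_pos hh0)).integrableOn_sq hnK)
            (integrableOn_const (isCompact_cyl _ _).measure_lt_top.ne)
            (isCompact_cyl _ _).measurableSet fun q _ => ?_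
          refine pow_le_one₀ (by positivity) (pow_le_one₀ (by positivity) (max_le ?_ zero_le_one))
          linarith [zeroExt_le_one hv01 q]
      _ = volume.real (cyl δ ((n + 1) * δ)) := by simp
      _ ≤ V * ((n + 1) * δ) ^ 6 := hvol _ _ hδ (le_mul_of_one_le_left hδ.le (by simp))
      _ ≤ V * (x * δ) ^ 6 := by gcongr
  have hpow : x ^ 6 ≤ 720 * (2 / β) ^ 6 * Real.exp (β / 2 * x) := by
    have := Real.pow_div_factorial_le_exp (β / 2 * x) (by positivity) 6
    calc x ^ 6 = 720 * (2 / β) ^ 6 * ((β / 2 * x) ^ 6 / Nat.factorial 6) := by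
          norm_num [Nat.factorial]
          field_simp
      _ ≤ 720 * (2 / β) ^ 6 * Real.exp (β / 2 * x) := by gcongr
  have hn3 : Real.exp (-β * n) ≤ Real.exp (3 * β) * Real.exp (-β * x) := by
    rw [← Real.exp_add, Real.exp_le_exp]
    nlinarith
  have hh6 : D * Real.exp (-(β / 2) * x) ≤ h ^ 6 := by
    have e : Real.exp (-(β / 2) * x) = Real.exp (-(β / 12) * x) ^ 6 := by
      rw [← Real.exp_nat_mul]
      congr 1
      push_cast
      ring
    rw [hh, hexp, mul_pow, e]
    gcongr
    calc D ≤ 1 + D := by linarith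
      _ ≤ (1 + D) ^ 6 := le_self_pow₀ (by linarith) (by norm_num)
  refine (hdecay δ (x * δ) a _ hδ ha hla haL (hf _ (half_pos hh0)) n hnK).trans ?_
  calc Real.exp (-β * n) *
        ∫ q in cyl δ ((n + 1) * δ), (max (zeroExt ε δ (x * δ) v q - h / 2) 0 ^ 3) ^ 2
      ≤ Real.exp (3 * β) * Real.exp (-β * x) * (V * (x * δ) ^ 6) := by gcongr
    _ = Real.exp (3 * β) * Real.exp (-β * x) * V * δ ^ 6 * x ^ 6 := by ring
    _ ≤ Real.exp (3 * β) * Real.exp (-β * x) * V * δ ^ 6 *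
        (720 * (2 / β) ^ 6 * Real.exp (β / 2 * x)) := by gcongr
    _ = c * (D * (Real.exp (-β * x) * Real.exp (β / 2 * x)) * δ ^ 6) := by
        rw [hD]
        field_simp
    _ = c * (D * Real.exp (-(β / 2) * x) * δ ^ 6) := by
        rw [← Real.exp_add]
        ring_nf
    _ ≤ c * (h ^ 6 * δ ^ 6) := by gcongr
end
end

section
/- Let a, b ∈ ℝ and define the quartic polynomial Q(ξ) := b + a·ξ − ξ² − (b/6)·ξ³ − (a/24)·ξ⁴. Then: (i) Q has no real root of multiplicity at least 3, i.e. there is no ξ₀ ∈ ℝ with Q(ξ₀) = Q'(ξ₀) = Q''(ξ₀) = 0; and (ii) if ξ* ∈ ℝ is a double root of Q (that is, Q(ξ*) = Q'(ξ*) = 0) satisfying b + (a/2)·ξ* ≠ 0, then ξ* = −12^{1/3} and b + (a/2)·ξ* = ξ*²/3. -/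
open Real

noncomputable section

/-- The profile quartic `Q(ξ) = b + aξ − ξ² − (b/6)ξ³ − (a/24)ξ⁴`. -/
def Qpoly (a b : ℝ) : ℝ → ℝ :=
  fun ξ => b + a * ξ - ξ ^ 2 - (b / 6) * ξ ^ 3 - (a / 24) * ξ ^ 4

theorem hasDerivAt_Qpoly (a b ξ : ℝ) :
    HasDerivAt (Qpoly a b) (a - 2 * ξ - (b / 2) * ξ ^ 2 - (a / 6) * ξ ^ 3) ξ := by
  have h := ((((hasDerivAt_const ξ b).add ((hasDerivAt_id ξ).const_mul a)).sub
    (hasDerivAt_pow 2 ξ)).sub ((hasDerivAt_pow 3 ξ).const_mul (b / 6))).sub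
    ((hasDerivAt_pow 4 ξ).const_mul (a / 24))
  refine h.congr_deriv ?_
  norm_num
  ring

theorem deriv_Qpoly (a b : ℝ) :
    deriv (Qpoly a b) = fun ξ => a - 2 * ξ - (b / 2) * ξ ^ 2 - (a / 6) * ξ ^ 3 :=
  funext fun ξ => (hasDerivAt_Qpoly a b ξ).deriv

theorem deriv_deriv_Qpoly (a b ξ : ℝ) :
    deriv (deriv (Qpoly a b)) ξ = -2 - ξ * (b + (a / 2) * ξ) := by
  rw [deriv_Qpoly]
  have h := ((((hasDerivAt_const ξ a).sub ((hasDerivAt_id ξ).const_mul 2)).sub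
    ((hasDerivAt_pow 2 ξ).const_mul (b / 2))).sub ((hasDerivAt_pow 3 ξ).const_mul (a / 6)))
  refine (h.congr_deriv ?_).deriv
  norm_num
  ring

/-- The identity `Q(ξ) − (ξ/2)Q'(ξ) = (b + (a/2)ξ)(1 + ξ³/12)`. -/
theorem Qpoly_sub_half_mul_deriv (a b ξ : ℝ) :
    Qpoly a b ξ - ξ / 2 * deriv (Qpoly a b) ξ = (b + (a / 2) * ξ) * (1 + ξ ^ 3 / 12) := by
  rw [deriv_Qpoly]
  simp only [Qpoly]
  ring

theorem cube_eq_of_double_root {a b ξ : ℝ} (h0 : Qpoly a b ξ = 0)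
    (h1 : deriv (Qpoly a b) ξ = 0) (hne : b + (a / 2) * ξ ≠ 0) : ξ ^ 3 = -12 := by
  have h := Qpoly_sub_half_mul_deriv a b ξ
  rw [h0, h1, mul_zero, sub_zero, eq_comm, mul_eq_zero] at h
  linarith [h.resolve_left hne]

theorem add_half_mul_eq_of_cube_eq {a b ξ : ℝ} (h1 : deriv (Qpoly a b) ξ = 0)
    (h3 : ξ ^ 3 = -12) : b + (a / 2) * ξ = ξ ^ 2 / 3 := by
  simp only [deriv_Qpoly] at h1
  linear_combination (ξ / 6) * h1 + (b / 12 + a * ξ / 36) * h3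

theorem eq_neg_rpow_of_cube_eq {ξ : ℝ} (h3 : ξ ^ 3 = -12) :
    ξ = -(12 : ℝ) ^ ((1 : ℝ) / 3) := by
  have hξ : 0 ≤ -ξ := by
    by_contra! h
    have : 0 < ξ ^ 3 := pow_pos (by linarith) 3
    linarith
  have h12 : (12 : ℝ) = (-ξ) ^ (3 : ℕ) := by linear_combination h3
  have h := Real.pow_rpow_inv_natCast hξ three_ne_zero
  rw [h12, one_div]
  push_cast at h
  rw [h, neg_neg]

/-- `Q` has no triple root, and any double root `ξ*` with `b + (a/2)ξ* ≠ 0` satisfies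
`ξ* = −12^{1/3}` and `b + (a/2)ξ* = ξ*²/3`. -/
theorem stmt19 (a b : ℝ) :
    (¬ ∃ ξ₀ : ℝ, Qpoly a b ξ₀ = 0 ∧ deriv (Qpoly a b) ξ₀ = 0 ∧
      deriv (deriv (Qpoly a b)) ξ₀ = 0) ∧
    (∀ ξs : ℝ, Qpoly a b ξs = 0 → deriv (Qpoly a b) ξs = 0 → b + (a / 2) * ξs ≠ 0 →
      ξs = -(12 : ℝ) ^ ((1:ℝ)/3) ∧ b + (a / 2) * ξs = ξs ^ 2 / 3) := by
  refine ⟨?_, fun ξ h0 h1 hne => ?_⟩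
  · rintro ⟨ξ, h0, h1, h2⟩
    rw [deriv_deriv_Qpoly] at h2
    have hne : b + (a / 2) * ξ ≠ 0 := by
      intro h
      rw [h] at h2
      norm_num at h2
    have h3 := cube_eq_of_double_root h0 h1 hne
    rw [add_half_mul_eq_of_cube_eq h1 h3] at h2
    linarith [show ξ * (ξ ^ 2 / 3) = ξ ^ 3 / 3 by ring]
  · have h3 := cube_eq_of_double_root h0 h1 hne
    exact ⟨eq_neg_rpow_of_cube_eq h3, add_half_mul_eq_of_cube_eq h1 h3⟩
end
end
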